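/- Let Λ be a finitely aligned k-graph and let 𝓔 ⊆ FE(Λ) be satiated, and let {S_𝓔(λ)} be the 𝓔-compatible boundary-path representation on ℓ²(∂(Λ;𝓔)). Then S_𝓔(v) ≠ 0 for every vertex v. Moreover, for every vertex v and every finite subset E ⊆ vΛ \ Λ⁰, ∏_{λ∈E}(S_𝓔(v) − S_𝓔(λ)S_𝓔(λ)*) = 0 if and only if E ∈ 𝓔. -/

import Mathlib

open scoped ENNReal

attribute [local instance] Classical.propDecidable

/-- Product of `f` over a set `S`, in some arbitrary order (junk value `1` if `S` is
infinite).  Used for products of commuting projections. -/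
noncomputable def listProd {ι A : Type*} [Monoid A] (S : Set ι) (f : ι → A) : A :=
  if h : S.Finite then (h.toFinset.toList.map f).prod else 1

/-- A `k`-graph: a countable category `Λ` (whose morphisms are the terms of `Path`, with
vertices identified with the morphisms of degree `0`) together with a degree functor
`d : Λ → ℕ^k` satisfying the factorisation property. -/
structure KGraph (k : ℕ) where
  Path : Type
  countable : Countable Path
  d : Path → Fin k → ℕ
  r : Path → Path
  s : Path → Path
  comp : Path → Path → Path
  d_r : ∀ lam, d (r lam) = 0
  d_s : ∀ lam, d (s lam) = 0
  r_r : ∀ lam, r (r lam) = r lam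
  s_r : ∀ lam, s (r lam) = r lam
  r_s : ∀ lam, r (s lam) = s lam
  s_s : ∀ lam, s (s lam) = s lam
  comp_source : ∀ lam, comp lam (s lam) = lam
  range_comp : ∀ lam, comp (r lam) lam = lam
  r_comp : ∀ lam mu, s lam = r mu → r (comp lam mu) = r lam
  s_comp : ∀ lam mu, s lam = r mu → s (comp lam mu) = s mu
  d_comp : ∀ lam mu, s lam = r mu → d (comp lam mu) = d lam + d mu
  comp_assoc : ∀ lam mu nu, s lam = r mu → s mu = r nu →
    comp (comp lam mu) nu = comp lam (comp mu nu)
  factor : ∀ lam m n, d lam = m + n →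
    ∃! p : Path × Path, s p.1 = r p.2 ∧ d p.1 = m ∧ d p.2 = n ∧ comp p.1 p.2 = lam

namespace KGraph

variable {k : ℕ} (Λ : KGraph k)

/-- Vertices are identified with the paths of degree `0`. -/
def IsVertex (v : Λ.Path) : Prop := Λ.d v = 0

/-- The unique factorisation of `lam` as a product of a path of degree `m` and the
remaining tail (junk value if `¬ m ≤ d lam`). -/
noncomputable def split (lam : Λ.Path) (m : Fin k → ℕ) : Λ.Path × Λ.Path :=
  if h : m ≤ Λ.d lam then
    (Λ.factor lam m (Λ.d lam - m) (by
      funext i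
      exact (Nat.add_sub_cancel' (h i)).symm)).choose
  else (lam, lam)

/-- The segment `λ(m,n)` of the path `λ`: the unique path of degree `n - m` such that
`λ = λ(0,m) λ(m,n) λ(n, d λ)` (meaningful for `m ≤ n ≤ d λ`). -/
noncomputable def seg (lam : Λ.Path) (m n : Fin k → ℕ) : Λ.Path :=
  (Λ.split (Λ.split lam n).1 m).2

/-- `MCE(μ,ν)`: minimal common extensions of `μ` and `ν`. -/
def MCE (mu nu : Λ.Path) : Set Λ.Path :=
  {lam | Λ.d lam = Λ.d mu ⊔ Λ.d nu ∧ Λ.seg lam 0 (Λ.d mu) = mu ∧ Λ.seg lam 0 (Λ.d nu) = nu}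

/-- `Λ^min(μ,ν) = {(α,β) : μα = νβ ∈ MCE(μ,ν)}`. -/
def Lmin (mu nu : Λ.Path) : Set (Λ.Path × Λ.Path) :=
  {p | Λ.s mu = Λ.r p.1 ∧ Λ.s nu = Λ.r p.2 ∧ Λ.comp mu p.1 = Λ.comp nu p.2 ∧
    Λ.comp mu p.1 ∈ Λ.MCE mu nu}

/-- `Ext(μ;E)`: extensions of `μ` with respect to `E`. -/
def Ext (mu : Λ.Path) (E : Set Λ.Path) : Set Λ.Path :=
  {a | Λ.r a = Λ.s mu ∧ ∃ nu ∈ E, ∃ b, (a, b) ∈ Λ.Lmin mu nu}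

/-- `Λ` is finitely aligned if all the sets `MCE(μ,ν)` are finite. -/
def FinitelyAligned : Prop := ∀ mu nu, (Λ.MCE mu nu).Finite

/-- `E ⊆ vΛ` is exhaustive if `Ext(λ;E) ≠ ∅` for all `λ ∈ vΛ`. -/
def Exhaustive (v : Λ.Path) (E : Set Λ.Path) : Prop :=
  ∀ lam, Λ.r lam = v → (Λ.Ext lam E).Nonempty

/-- `E ∈ vFE(Λ)`: `E ⊆ vΛ \ {v}` is finite and exhaustive (so `r(E) = v`). -/
def FEat (v : Λ.Path) (E : Set Λ.Path) : Prop :=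
  Λ.IsVertex v ∧ (∀ lam ∈ E, Λ.r lam = v ∧ lam ≠ v) ∧ E.Finite ∧ Λ.Exhaustive v E

/-- `FE(Λ)`: the finite exhaustive sets. -/
def FE : Set (Set Λ.Path) := {E | ∃ v, Λ.FEat v E}

/-- `λE = {λμ : μ ∈ E, r(μ) = s(λ)}`. -/
def lamSet (lam : Λ.Path) (E : Set Λ.Path) : Set Λ.Path :=
  {x | ∃ mu ∈ E, Λ.s lam = Λ.r mu ∧ Λ.comp lam mu = x}

/-- `EΛ = {λμ : λ ∈ E, r(μ) = s(λ)}`. -/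
def setLam (E : Set Λ.Path) : Set Λ.Path :=
  {x | ∃ lam ∈ E, ∃ mu, Λ.s lam = Λ.r mu ∧ Λ.comp lam mu = x}

/-- `𝓔 ⊆ FE(Λ)` is satiated if it satisfies (S1)--(S4). -/
def Satiated (𝓔 : Set (Set Λ.Path)) : Prop :=
  𝓔 ⊆ Λ.FE ∧
  (∀ G ∈ 𝓔, ∀ E ∈ Λ.FE, G ⊆ E → E ∈ 𝓔) ∧
  (∀ G ∈ 𝓔, ∀ v, Λ.FEat v G → ∀ mu, Λ.r mu = v → mu ∉ Λ.setLam G → Λ.Ext mu G ∈ 𝓔) ∧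
  (∀ G ∈ 𝓔, ∀ n : Λ.Path → Fin k → ℕ, (∀ lam ∈ G, 0 < n lam ∧ n lam ≤ Λ.d lam) →
    ((fun lam => Λ.seg lam 0 (n lam)) '' G) ∈ 𝓔) ∧
  (∀ G ∈ 𝓔, ∀ G' ⊆ G, ∀ Gl : Λ.Path → Set Λ.Path,
    (∀ lam ∈ G', Gl lam ∈ 𝓔 ∧ Λ.FEat (Λ.s lam) (Gl lam)) →
    ((G \ G') ∪ ⋃ lam ∈ G', Λ.lamSet lam (Gl lam)) ∈ 𝓔)

/-- The satiation `𝓔̄` of `𝓔`: the smallest satiated subset of `FE(Λ)` containing `𝓔`. -/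
def satiation (𝓔 : Set (Set Λ.Path)) : Set (Set Λ.Path) :=
  ⋂₀ {F | 𝓔 ⊆ F ∧ Λ.Satiated F}

/-- `ΠE`: the smallest subset of `Λ` containing `E` which is closed under the operation
`(λ,μ,σ) ↦ λ Ext(μ;{σ})` for `λ,μ,σ ∈ ΠE` with `d(λ) = d(μ)`, `s(λ) = s(μ)`. -/
def PiSet (E : Set Λ.Path) : Set Λ.Path :=
  ⋂₀ {G | E ⊆ G ∧ ∀ lam mu sig, lam ∈ G → mu ∈ G → sig ∈ G →
    Λ.d lam = Λ.d mu → Λ.s lam = Λ.s mu → Λ.lamSet lam (Λ.Ext mu {sig}) ⊆ G}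

/-- `Σ₁(𝓔)`: finite sets `F ⊆ r(E)Λ \ Λ⁰` containing some `E ∈ 𝓔`. -/
def Sig1 (𝓔 : Set (Set Λ.Path)) : Set (Set Λ.Path) :=
  {F | ∃ E ∈ 𝓔, ∃ v, Λ.FEat v E ∧ E ⊆ F ∧ F.Finite ∧
    ∀ lam ∈ F, Λ.r lam = v ∧ ¬ Λ.IsVertex lam}

/-- `Σ₂(𝓔) = {Ext(μ;E) : E ∈ 𝓔, μ ∈ r(E)Λ \ EΛ}`. -/
def Sig2 (𝓔 : Set (Set Λ.Path)) : Set (Set Λ.Path) :=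
  {F | ∃ E ∈ 𝓔, ∃ v, Λ.FEat v E ∧ ∃ mu, Λ.r mu = v ∧ mu ∉ Λ.setLam E ∧ F = Λ.Ext mu E}

/-- `Σ₃(𝓔) = {{λ(0,n_λ) : λ ∈ E} : E ∈ 𝓔, 0 < n_λ ≤ d(λ)}`. -/
def Sig3 (𝓔 : Set (Set Λ.Path)) : Set (Set Λ.Path) :=
  {F | ∃ E ∈ 𝓔, ∃ n : Λ.Path → Fin k → ℕ, (∀ lam ∈ E, 0 < n lam ∧ n lam ≤ Λ.d lam) ∧
    F = (fun lam => Λ.seg lam 0 (n lam)) '' E}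

/-- `Σ₄(𝓔) = {(E \ F) ∪ ⋃_{λ ∈ F} λ F_λ : E ∈ 𝓔, F ⊆ E, F_λ ∈ s(λ)𝓔}`. -/
def Sig4 (𝓔 : Set (Set Λ.Path)) : Set (Set Λ.Path) :=
  {G | ∃ E ∈ 𝓔, ∃ F ⊆ E, ∃ Fl : Λ.Path → Set Λ.Path,
    (∀ lam ∈ F, Fl lam ∈ 𝓔 ∧ Λ.FEat (Λ.s lam) (Fl lam)) ∧
    G = (E \ F) ∪ ⋃ lam ∈ F, Λ.lamSet lam (Fl lam)}

/-- `Σ = Σ₄ ∘ Σ₃ ∘ Σ₂ ∘ Σ₁`. -/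
def SigmaStep (𝓔 : Set (Set Λ.Path)) : Set (Set Λ.Path) :=
  Λ.Sig4 (Λ.Sig3 (Λ.Sig2 (Λ.Sig1 𝓔)))

/-- `Σ^∞(𝓔) = ⋃_{n ≥ 1} Σ^n(𝓔)`. -/
def SigmaInf (𝓔 : Set (Set Λ.Path)) : Set (Set Λ.Path) :=
  ⋃ n : ℕ, (Λ.SigmaStep)^[n + 1] 𝓔

section StarAlgebra

variable {A : Type*} [Ring A] [StarRing A]

/-- The product `∏_{λ ∈ E} (t_v - t_λ t_λ*)` (the factors pairwise commute for any
family satisfying (TCK1)--(TCK3), so the implicit choice of ordering is immaterial). -/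
noncomputable def gapProd (t : Λ.Path → A) (v : Λ.Path) (E : Set Λ.Path) : A :=
  listProd E fun lam => t v - t lam * star (t lam)

/-- Conditions (TCK1)--(TCK3) on a family `{t_λ}`. -/
def TCKFamily (t : Λ.Path → A) : Prop :=
  (∀ v, Λ.IsVertex v → star (t v) = t v ∧ t v * t v = t v) ∧
  (∀ v w, Λ.IsVertex v → Λ.IsVertex w → v ≠ w → t v * t w = 0) ∧
  (∀ lam mu, Λ.s lam = Λ.r mu → t lam * t mu = t (Λ.comp lam mu)) ∧
  (∀ lam mu, star (t lam) * t mu = ∑ᶠ p ∈ Λ.Lmin lam mu, t p.1 * star (t p.2))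

/-- A relative Cuntz-Krieger `(Λ;𝓔)`-family: (TCK1)--(TCK3) together with (CK). -/
def RCKFamily (𝓔 : Set (Set Λ.Path)) (t : Λ.Path → A) : Prop :=
  Λ.TCKFamily t ∧ ∀ E ∈ 𝓔, ∀ v, Λ.FEat v E → Λ.gapProd t v E = 0

/-- `Θ(t)^{ΠE}_{λ,μ} = t_λ (∏_{λν ∈ ΠE, d(ν) > 0} (t_{s(λ)} - t_ν t_ν*)) t_μ*`. -/
noncomputable def Theta (t : Λ.Path → A) (E : Set Λ.Path) (lam mu : Λ.Path) : A :=
  t lam *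
    listProd {nu | Λ.s lam = Λ.r nu ∧ ¬ Λ.IsVertex nu ∧ Λ.comp lam nu ∈ Λ.PiSet E}
      (fun nu => t (Λ.s lam) - t nu * star (t nu)) *
    star (t mu)

end StarAlgebra

end KGraph

/-- A graph morphism `x : Ω_{k,m} → Λ`, encoded by its length `m = d(x) ∈ (ℕ∪{∞})^k`
and its values `x(p,q)` on the morphisms `(p,q)` of `Ω_{k,m}` (with the junk value
`x(0,0)` outside the meaningful domain, so graph morphisms are extensional). -/
structure GMor {k : ℕ} (Λ : KGraph k) where
  len : Fin k → ℕ∞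
  seg : (Fin k → ℕ) → (Fin k → ℕ) → Λ.Path
  d_seg : ∀ p q, p ≤ q → (∀ i, (q i : ℕ∞) ≤ len i) → Λ.d (seg p q) = q - p
  r_seg : ∀ p q, p ≤ q → (∀ i, (q i : ℕ∞) ≤ len i) → Λ.r (seg p q) = seg p p
  s_seg : ∀ p q, p ≤ q → (∀ i, (q i : ℕ∞) ≤ len i) → Λ.s (seg p q) = seg q q
  comp_seg : ∀ p q u, p ≤ q → q ≤ u → (∀ i, (u i : ℕ∞) ≤ len i) →
    Λ.comp (seg p q) (seg q u) = seg p u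
  seg_junk : ∀ p q, ¬ (p ≤ q ∧ ∀ i, (q i : ℕ∞) ≤ len i) → seg p q = seg 0 0

namespace GMor

variable {k : ℕ} {Λ : KGraph k}

/-- The range `r(x) = x(0)` of a graph morphism. -/
def range (x : GMor Λ) : Λ.Path := x.seg 0 0

/-- `y = x|_n^{d(x)}`, the restriction of `x` (defined for `n ≤ d(x)`):
`d(y) = d(x) - n` and `y(p,q) = x(n+p, n+q)`. -/
def IsRestriction (y x : GMor Λ) (n : Fin k → ℕ) : Prop :=
  (∀ i, y.len i = x.len i - (n i : ℕ∞)) ∧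
  ∀ p q, p ≤ q → (∀ i, (q i : ℕ∞) ≤ y.len i) → y.seg p q = x.seg (n + p) (n + q)

/-- `y = λx`, the extension of `x` by `λ ∈ Λ r(x)`: `d(y) = d(λ) + d(x)`,
`y(0, d(λ)) = λ` and `y(d(λ), d(λ)+n) = x(0,n)` for `n ≤ d(x)`. -/
def IsExtension (y : GMor Λ) (lam : Λ.Path) (x : GMor Λ) : Prop :=
  (∀ i, y.len i = (Λ.d lam i : ℕ∞) + x.len i) ∧
  y.seg 0 (Λ.d lam) = lam ∧
  ∀ n : Fin k → ℕ, (∀ i, (n i : ℕ∞) ≤ x.len i) →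
    y.seg (Λ.d lam) (Λ.d lam + n) = x.seg 0 n

/-- `x ∈ FΛ^∞`: `x` has an initial segment belonging to `F`. -/
def HasInit (x : GMor Λ) (F : Set Λ.Path) : Prop :=
  ∃ lam ∈ F, (∀ i, (Λ.d lam i : ℕ∞) ≤ x.len i) ∧ x.seg 0 (Λ.d lam) = lam

/-- `z` restricts to `x` on `Ω_{k, d(x)}`. -/
def Agrees (z x : GMor Λ) : Prop :=
  ∀ p q, p ≤ q → (∀ i, (q i : ℕ∞) ≤ x.len i) → z.seg p q = x.seg p q

/-- `z ∈ MCE(x,y)` for graph morphisms `x, y`. -/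
def IsMCE (z x y : GMor Λ) : Prop :=
  (∀ i, z.len i = max (x.len i) (y.len i)) ∧ z.Agrees x ∧ z.Agrees y

/-- `x` is aperiodic: for distinct `λ, μ ∈ Λ r(x)`, `MCE(λx, μx) = ∅`. -/
def Aperiodic (x : GMor Λ) : Prop :=
  ∀ lam mu : Λ.Path, lam ≠ mu → Λ.s lam = x.range → Λ.s mu = x.range →
    ∀ lx mx : GMor Λ, lx.IsExtension lam x → mx.IsExtension mu x →
      ∀ z : GMor Λ, ¬ z.IsMCE lx mx

end GMor

namespace KGraph

variable {k : ℕ} (Λ : KGraph k)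

/-- `x ∈ ∂(Λ;𝓔)`: an `𝓔`-compatible boundary path. -/
def IsBdry (𝓔 : Set (Set Λ.Path)) (x : GMor Λ) : Prop :=
  ∀ n : Fin k → ℕ, (∀ i, (n i : ℕ∞) ≤ x.len i) →
    ∀ E ∈ 𝓔, Λ.FEat (x.seg n n) E →
      ∃ lam ∈ E, (∀ i, ((n + Λ.d lam) i : ℕ∞) ≤ x.len i) ∧ x.seg n (n + Λ.d lam) = lam

/-- Condition (C): aperiodic `𝓔`-compatible boundary paths out of every vertex, and
avoiding any given `F ∈ vFE(Λ) \ 𝓔`. -/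
def CondC (𝓔 : Set (Set Λ.Path)) : Prop :=
  (∀ v, Λ.IsVertex v → ∃ x : GMor Λ, Λ.IsBdry 𝓔 x ∧ x.range = v ∧ x.Aperiodic) ∧
  (∀ v F, Λ.FEat v F → F ∉ 𝓔 →
    ∃ x : GMor Λ, Λ.IsBdry 𝓔 x ∧ x.range = v ∧ ¬ x.HasInit F ∧ x.Aperiodic)

end KGraph


namespace KGraph

variable {k : ℕ} {Λ : KGraph k}

theorem comp_inj {a b a' b' : Λ.Path} (h : Λ.s a = Λ.r b) (h' : Λ.s a' = Λ.r b')
    (hd : Λ.d a = Λ.d a') (hc : Λ.comp a b = Λ.comp a' b') : a = a' ∧ b = b' := by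
  have h1 := Λ.d_comp a b h
  have h2 := Λ.d_comp a' b' h'
  have hb : Λ.d b' = Λ.d b := by
    rw [hc, h2, hd] at h1
    exact add_left_cancel h1
  have := (Λ.factor (Λ.comp a b) (Λ.d a) (Λ.d b) h1).unique (y₁ := (a, b)) (y₂ := (a', b'))
    ⟨h, rfl, rfl, rfl⟩ ⟨h', hd.symm, hb, hc.symm⟩
  exact Prod.mk.inj this

theorem comp_left_cancel {a b b' : Λ.Path} (h : Λ.s a = Λ.r b) (h' : Λ.s a = Λ.r b')
    (hc : Λ.comp a b = Λ.comp a b') : b = b' :=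
  (comp_inj h h' rfl hc).2

theorem range_eq_of_isVertex {v : Λ.Path} (hv : Λ.IsVertex v) : Λ.r v = v :=
  (comp_inj (Λ.s_r v) (Λ.r_s v).symm ((Λ.d_r v).trans hv.symm)
    ((Λ.range_comp v).trans (Λ.comp_source v).symm)).1

theorem source_eq_of_isVertex {v : Λ.Path} (hv : Λ.IsVertex v) : Λ.s v = v := by
  have := Λ.s_r v
  rwa [range_eq_of_isVertex hv] at this

theorem exists_comp_eq {lam : Λ.Path} {m : Fin k → ℕ} (h : m ≤ Λ.d lam) :
    ∃ a b, Λ.s a = Λ.r b ∧ Λ.d a = m ∧ Λ.comp a b = lam := by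
  obtain ⟨p, ⟨h1, h2, -, h4⟩, -⟩ := Λ.factor lam m (Λ.d lam - m) (add_tsub_cancel_of_le h).symm
  exact ⟨p.1, p.2, h1, h2, h4⟩

theorem split_comp {a b : Λ.Path} (h : Λ.s a = Λ.r b) :
    Λ.split (Λ.comp a b) (Λ.d a) = (a, b) := by
  have hle : Λ.d a ≤ Λ.d (Λ.comp a b) := by
    rw [Λ.d_comp a b h]; exact le_self_add
  unfold split
  rw [dif_pos hle]
  have hf := Λ.factor (Λ.comp a b) (Λ.d a) (Λ.d (Λ.comp a b) - Λ.d a)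
    (add_tsub_cancel_of_le hle).symm
  obtain ⟨h1, h2, -, h4⟩ := hf.choose_spec.1
  obtain ⟨e1, e2⟩ := comp_inj h1 h h2 h4
  exact Prod.ext e1 e2

theorem seg_comp_comp {a b c : Λ.Path} (hab : Λ.s a = Λ.r b) (hbc : Λ.s b = Λ.r c) :
    Λ.seg (Λ.comp a (Λ.comp b c)) (Λ.d a) (Λ.d a + Λ.d b) = b := by
  unfold seg
  have h : Λ.s (Λ.comp a b) = Λ.r c := (Λ.s_comp a b hab).trans hbc
  rw [← Λ.comp_assoc a b c hab hbc, ← Λ.d_comp a b hab, split_comp h, split_comp hab]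

theorem seg_comp_zero {a b : Λ.Path} (h : Λ.s a = Λ.r b) :
    Λ.seg (Λ.comp a b) 0 (Λ.d a) = a := by
  have h0 : Λ.d (Λ.r a) = 0 := Λ.d_r a
  have := seg_comp_comp (a := Λ.r a) (Λ.s_r a) h
  rwa [h0, zero_add, ← Λ.r_comp a b h, Λ.range_comp] at this

theorem seg_self {lam : Λ.Path} : Λ.seg lam 0 (Λ.d lam) = lam := by
  have := seg_comp_zero (Λ.r_s lam).symm
  rwa [Λ.comp_source] at this

/-- Factorisation of a path around the segment from `m` to `n`. -/
theorem exists_comp_comp_eq {lam : Λ.Path} {m n : Fin k → ℕ} (hmn : m ≤ n) (hn : n ≤ Λ.d lam) :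
    ∃ a b c, Λ.s a = Λ.r b ∧ Λ.s b = Λ.r c ∧ Λ.d a = m ∧ Λ.d a + Λ.d b = n ∧
      Λ.comp a (Λ.comp b c) = lam ∧ Λ.seg lam m n = b := by
  obtain ⟨e, c, hec, hde, rfl⟩ := exists_comp_eq hn
  obtain ⟨a, b, hab, rfl, rfl⟩ := exists_comp_eq (hmn.trans_eq hde.symm)
  have hbc : Λ.s b = Λ.r c := by rw [← hec, Λ.s_comp a b hab]
  have hd : Λ.d a + Λ.d b = n := by rw [← hde, Λ.d_comp a b hab]
  refine ⟨a, b, c, hab, hbc, rfl, hd, (Λ.comp_assoc a b c hab hbc).symm, ?_⟩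
  rw [Λ.comp_assoc a b c hab hbc, ← hd, seg_comp_comp hab hbc]

variable (Λ) in
/-- `a` is an initial segment of `b`. -/
def IsPrefix (a b : Λ.Path) : Prop := ∃ c, Λ.s a = Λ.r c ∧ Λ.comp a c = b

theorem IsPrefix.refl (a : Λ.Path) : Λ.IsPrefix a a := ⟨Λ.s a, (Λ.r_s a).symm, Λ.comp_source a⟩

theorem IsPrefix.trans {a b c : Λ.Path} (h : Λ.IsPrefix a b) (h' : Λ.IsPrefix b c) :
    Λ.IsPrefix a c := by
  obtain ⟨e, he, rfl⟩ := h
  obtain ⟨f, hf, rfl⟩ := h'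
  rw [Λ.s_comp a e he] at hf
  exact ⟨Λ.comp e f, by rw [Λ.r_comp e f hf, he], (Λ.comp_assoc a e f he hf).symm⟩

theorem IsPrefix.range_eq {a b : Λ.Path} (h : Λ.IsPrefix a b) : Λ.r b = Λ.r a := by
  obtain ⟨e, he, rfl⟩ := h
  exact Λ.r_comp a e he

theorem IsPrefix.d_le {a b : Λ.Path} (h : Λ.IsPrefix a b) : Λ.d a ≤ Λ.d b := by
  obtain ⟨e, he, rfl⟩ := h
  rw [Λ.d_comp a e he]; exact le_self_add

theorem IsPrefix.seg_zero {a b : Λ.Path} (h : Λ.IsPrefix a b) : Λ.seg b 0 (Λ.d a) = a := by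
  obtain ⟨e, he, rfl⟩ := h
  exact seg_comp_zero he

theorem isPrefix_seg_zero {lam : Λ.Path} {m : Fin k → ℕ} (h : m ≤ Λ.d lam) :
    Λ.IsPrefix (Λ.seg lam 0 m) lam ∧ Λ.d (Λ.seg lam 0 m) = m := by
  obtain ⟨a, b, hab, rfl, rfl⟩ := exists_comp_eq h
  rw [seg_comp_zero hab]
  exact ⟨⟨b, hab, rfl⟩, rfl⟩

theorem IsPrefix.seg_eq {a b : Λ.Path} (h : Λ.IsPrefix a b) {p q : Fin k → ℕ} (hpq : p ≤ q)
    (hq : q ≤ Λ.d a) : Λ.seg b p q = Λ.seg a p q := by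
  obtain ⟨e, he, rfl⟩ := h
  obtain ⟨x, y, z, hxy, hyz, rfl, rfl, rfl, hs⟩ := exists_comp_comp_eq hpq hq
  have hyz' : Λ.s x = Λ.r (Λ.comp y z) := by rw [Λ.r_comp y z hyz, hxy]
  have h1 : Λ.s (Λ.comp y z) = Λ.r e := by rw [← he, Λ.s_comp x _ hyz']
  have h2 : Λ.s z = Λ.r e := by rw [← h1, Λ.s_comp y z hyz]
  rw [hs, Λ.comp_assoc x _ e hyz' h1, Λ.comp_assoc y z e hyz h2, seg_comp_comp hxy]
  rw [Λ.r_comp z e h2, hyz]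

theorem IsPrefix.of_le {a b c : Λ.Path} (ha : Λ.IsPrefix a c) (hb : Λ.IsPrefix b c)
    (h : Λ.d a ≤ Λ.d b) : Λ.IsPrefix a b := by
  have h1 := hb.seg_eq (p := 0) (fun _ => Nat.zero_le _) h
  rw [ha.seg_zero] at h1
  rw [h1]
  exact (isPrefix_seg_zero h).1

theorem d_seg {lam : Λ.Path} {p q : Fin k → ℕ} (hpq : p ≤ q) (hq : q ≤ Λ.d lam) :
    Λ.d (Λ.seg lam p q) = q - p := by
  obtain ⟨x, y, z, hxy, hyz, rfl, rfl, rfl, hs⟩ := exists_comp_comp_eq hpq hq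
  rw [hs, add_tsub_cancel_left]

theorem comp_seg {lam : Λ.Path} {p q u : Fin k → ℕ} (hpq : p ≤ q) (hqu : q ≤ u)
    (hu : u ≤ Λ.d lam) : Λ.s (Λ.seg lam p q) = Λ.r (Λ.seg lam q u) ∧
      Λ.comp (Λ.seg lam p q) (Λ.seg lam q u) = Λ.seg lam p u := by
  obtain ⟨x, y, z, hxy, hyz, rfl, rfl, rfl, hs⟩ := exists_comp_comp_eq hqu hu
  obtain ⟨a, b, hab, rfl, rfl⟩ := exists_comp_eq hpq
  have hby : Λ.s b = Λ.r y := by rw [← hxy, Λ.s_comp a b hab]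
  have hyz' : Λ.s b = Λ.r (Λ.comp y z) := by rw [Λ.r_comp y z hyz, hby]
  have hbyz : Λ.s (Λ.comp b y) = Λ.r z := by rw [Λ.s_comp b y hby, hyz]
  have haby : Λ.s a = Λ.r (Λ.comp b y) := by rw [Λ.r_comp b y hby, hab]
  have h1 : Λ.seg (Λ.comp (Λ.comp a b) (Λ.comp y z)) (Λ.d a) (Λ.d (Λ.comp a b)) = b := by
    rw [Λ.comp_assoc a b _ hab hyz', Λ.d_comp a b hab, seg_comp_comp hab hyz']
  have h2 : Λ.seg (Λ.comp (Λ.comp a b) (Λ.comp y z)) (Λ.d a)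
      (Λ.d (Λ.comp a b) + Λ.d y) = Λ.comp b y := by
    rw [Λ.comp_assoc a b _ hab hyz', ← Λ.comp_assoc b y z hby hyz, Λ.d_comp a b hab, add_assoc,
      ← Λ.d_comp b y hby, seg_comp_comp haby hbyz]
  rw [h1, hs, h2]
  exact ⟨hby, rfl⟩

theorem seg_self_isVertex {lam : Λ.Path} {p : Fin k → ℕ} (hp : p ≤ Λ.d lam) :
    Λ.IsVertex (Λ.seg lam p p) := by
  rw [IsVertex, d_seg le_rfl hp, tsub_self]

theorem range_seg {lam : Λ.Path} {p q : Fin k → ℕ} (hpq : p ≤ q) (hq : q ≤ Λ.d lam) :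
    Λ.r (Λ.seg lam p q) = Λ.seg lam p p := by
  rw [← (comp_seg le_rfl hpq hq).1, source_eq_of_isVertex (seg_self_isVertex (hpq.trans hq))]

theorem source_seg {lam : Λ.Path} {p q : Fin k → ℕ} (hpq : p ≤ q) (hq : q ≤ Λ.d lam) :
    Λ.s (Λ.seg lam p q) = Λ.seg lam q q := by
  rw [(comp_seg hpq le_rfl hq).1, range_eq_of_isVertex (seg_self_isVertex hq)]

theorem seg_zero_zero (lam : Λ.Path) : Λ.seg lam 0 0 = Λ.r lam := by
  have h0 : (0 : Fin k → ℕ) ≤ Λ.d lam := fun _ => Nat.zero_le _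
  rw [← range_seg h0 le_rfl, seg_self]

/-- Two initial segments of a path have a minimal common extension below it. -/
theorem exists_mem_Lmin {a e x : Λ.Path} (ha : Λ.IsPrefix a x) (he : Λ.IsPrefix e x) :
    ∃ b c, (b, c) ∈ Λ.Lmin a e ∧ Λ.IsPrefix (Λ.comp a b) x := by
  obtain ⟨h1, h2⟩ := isPrefix_seg_zero (sup_le ha.d_le he.d_le)
  obtain ⟨b, hb, hab⟩ := ha.of_le h1 (le_sup_left.trans_eq h2.symm)
  obtain ⟨c, hc, hec⟩ := he.of_le h1 (le_sup_right.trans_eq h2.symm)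
  refine ⟨b, c, ⟨hb, hc, hab.trans hec.symm, ?_, ?_, ?_⟩, hab.symm ▸ h1⟩
  · rw [hab, h2]
  · exact seg_comp_zero hb
  · change Λ.seg (Λ.comp a b) 0 (Λ.d e) = e
    rw [hab, ← hec, seg_comp_zero hc]

theorem mem_setLam_Ext {a x : Λ.Path} {H : Set Λ.Path} (hax : Λ.s a = Λ.r x)
    (h : Λ.comp a x ∈ Λ.setLam H) : x ∈ Λ.setLam (Λ.Ext a H) := by
  obtain ⟨e, heH, he⟩ := h
  obtain ⟨b, c, hbc, t, ht, hx⟩ := exists_mem_Lmin (x := Λ.comp a x) ⟨x, hax, rfl⟩ he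
  have hab : Λ.s a = Λ.r b := hbc.1
  have hbt : Λ.s b = Λ.r t := by rw [← ht, Λ.s_comp a b hab]
  refine ⟨b, ⟨hab.symm, e, heH, c, hbc⟩, t, hbt, ?_⟩
  rw [Λ.comp_assoc a b t hab hbt] at hx
  exact comp_left_cancel (by rw [Λ.r_comp b t hbt, hab]) hax hx

theorem comp_mem_setLam_of_mem_Ext {a b : Λ.Path} {H : Set Λ.Path} (h : b ∈ Λ.Ext a H) :
    Λ.comp a b ∈ Λ.setLam H := by
  obtain ⟨-, e, he, c, -, hc, hcomp, -⟩ := h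
  exact ⟨e, he, c, hc, hcomp.symm⟩

theorem Ext_mono (a : Λ.Path) {G H : Set Λ.Path} (h : G ⊆ H) : Λ.Ext a G ⊆ Λ.Ext a H :=
  fun _ ⟨hr, e, he, hb⟩ => ⟨hr, e, h he, hb⟩

theorem FinitelyAligned.finite_Ext (hΛ : Λ.FinitelyAligned) (a : Λ.Path) {H : Set Λ.Path}
    (hH : H.Finite) : (Λ.Ext a H).Finite := by
  refine Set.Finite.of_finite_image (f := Λ.comp a)
    ((hH.biUnion fun e _ => hΛ a e).subset ?_) ?_
  · rintro _ ⟨b, ⟨-, e, he, c, hbc⟩, rfl⟩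
    exact Set.mem_biUnion he hbc.2.2.2
  · intro b hb b' hb' h
    exact comp_left_cancel hb.1.symm hb'.1.symm h

theorem not_isVertex_of_mem_Ext {a b : Λ.Path} {H : Set Λ.Path} (ha : a ∉ Λ.setLam H)
    (hb : b ∈ Λ.Ext a H) : ¬ Λ.IsVertex b := by
  intro hv
  refine ha ?_
  have := comp_mem_setLam_of_mem_Ext hb
  rwa [← range_eq_of_isVertex hv, hb.1, Λ.comp_source] at this

theorem FEat.nonempty {v : Λ.Path} {E : Set Λ.Path} (h : Λ.FEat v E) : E.Nonempty := by
  obtain ⟨-, -, e, he, -⟩ := h.2.2.2 v (range_eq_of_isVertex h.1)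
  exact ⟨e, he⟩

theorem Satiated.FEat_of_forall_range_eq {𝓔 : Set (Set Λ.Path)} (h𝓔 : Λ.Satiated 𝓔)
    {E : Set Λ.Path} (hE : E ∈ 𝓔) {v : Λ.Path} (h : ∀ lam ∈ E, Λ.r lam = v) : Λ.FEat v E := by
  obtain ⟨w, hw⟩ := h𝓔.1 hE
  obtain ⟨e, he⟩ := hw.nonempty
  rwa [← (hw.2.1 e he).1, h e he] at hw

/-- If `H` is not in the satiated set `𝓔`, then some member of each `G ∈ 𝓔` at the same vertex
can be followed without meeting `H` and without `Ext` entering `𝓔`. -/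
theorem Satiated.exists_Ext_notMem {𝓔 : Set (Set Λ.Path)} (h𝓔 : Λ.Satiated 𝓔)
    {w : Λ.Path} {G H : Set Λ.Path} (hG : G ∈ 𝓔) (hGw : Λ.FEat w G) (hHf : H.Finite)
    (hH : ∀ e ∈ H, Λ.r e = w ∧ ¬ Λ.IsVertex e) (hH𝓔 : H ∉ 𝓔) :
    ∃ a ∈ G, a ∉ Λ.setLam H ∧ Λ.Ext a H ∉ 𝓔 := by
  by_contra! hcon
  have hK := h𝓔.2.2.2.2 G hG {a | a ∈ G ∧ a ∉ Λ.setLam H} (fun a ha => ha.1)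
    (fun a => Λ.Ext a H) (fun a ha =>
      ⟨hcon a ha.1 ha.2, h𝓔.FEat_of_forall_range_eq (hcon a ha.1 ha.2) fun b hb => hb.1⟩)
  set K := (G \ {a | a ∈ G ∧ a ∉ Λ.setLam H}) ∪
    ⋃ a ∈ {a | a ∈ G ∧ a ∉ Λ.setLam H}, Λ.lamSet a (Λ.Ext a H)
  have hKH : ∀ x ∈ K, ∃ e ∈ H, Λ.IsPrefix e x := by
    rintro x (⟨hx, hx'⟩ | hx)
    · by_contra hc
      exact hx' ⟨hx, hc⟩
    · simp only [Set.mem_iUnion] at hx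
      obtain ⟨a, -, b, hb, -, rfl⟩ := hx
      exact comp_mem_setLam_of_mem_Ext hb
  choose! f hf hfx using hKH
  have hI := h𝓔.2.2.2.1 K hK (fun x => Λ.d (f x)) fun x hx =>
    ⟨lt_of_le_of_ne (fun _ => Nat.zero_le _) (Ne.symm (hH _ (hf x hx)).2), (hfx x hx).d_le⟩
  have hsub : (fun x => Λ.seg x 0 (Λ.d (f x))) '' K ⊆ H := by
    rintro _ ⟨x, hx, rfl⟩
    change Λ.seg x 0 (Λ.d (f x)) ∈ H
    rw [(hfx x hx).seg_zero]
    exact hf x hx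
  have hIw := h𝓔.FEat_of_forall_range_eq hI fun e he => (hH e (hsub he)).1
  refine hH𝓔 (h𝓔.2.1 _ hI H ⟨w, hGw.1, fun e he => ⟨(hH e he).1, ?_⟩, hHf, fun lam hlam =>
    (hIw.2.2.2 lam hlam).mono (Ext_mono lam hsub)⟩ hsub)
  rintro rfl
  exact (hH e he).2 hGw.1

theorem seg_of_isPrefix_comp {a b e : Λ.Path} (hab : Λ.s a = Λ.r b) (he : Λ.IsPrefix e b) :
    Λ.d a + Λ.d e ≤ Λ.d (Λ.comp a b) ∧
      Λ.seg (Λ.comp a b) (Λ.d a) (Λ.d a + Λ.d e) = e := by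
  rw [Λ.d_comp a b hab]
  refine ⟨add_le_add_right he.d_le _, ?_⟩
  obtain ⟨t, ht, rfl⟩ := he
  rw [Λ.r_comp e t ht] at hab
  exact seg_comp_comp hab ht

end KGraph

namespace GMor

variable {k : ℕ} {Λ : KGraph k}

theorem zero_le_len (x : GMor Λ) (i : Fin k) : (((0 : Fin k → ℕ) i : ℕ) : ℕ∞) ≤ x.len i := by
  simp

theorem le_len_of_le {x : GMor Λ} {p q : Fin k → ℕ} (hpq : p ≤ q)
    (hq : ∀ i, (q i : ℕ∞) ≤ x.len i) (i : Fin k) : (p i : ℕ∞) ≤ x.len i :=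
  (Nat.cast_le.2 (hpq i)).trans (hq i)

theorem seg_seg (x : GMor Λ) {p q m : Fin k → ℕ} (hpq : p ≤ q) (hqm : q ≤ m)
    (hm : ∀ i, (m i : ℕ∞) ≤ x.len i) : Λ.seg (x.seg 0 m) p q = x.seg p q := by
  have hq := le_len_of_le hqm hm
  have hp := le_len_of_le hpq hq
  have h0 : (0 : Fin k → ℕ) ≤ p := fun _ => Nat.zero_le _
  have hd1 : Λ.d (x.seg 0 p) = p := by rw [x.d_seg 0 p h0 hp, tsub_zero]
  have hd2 : Λ.d (x.seg 0 p) + Λ.d (x.seg p q) = q := by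
    rw [hd1, x.d_seg p q hpq hq, add_tsub_cancel_of_le hpq]
  have := KGraph.seg_comp_comp (a := x.seg 0 p) (b := x.seg p q) (c := x.seg q m)
    (by rw [x.s_seg 0 p h0 hp, x.r_seg p q hpq hq])
    (by rw [x.s_seg p q hpq hq, x.r_seg q m hqm hm])
  rwa [hd2, hd1, x.comp_seg p q m hpq hqm hm,
    x.comp_seg 0 p m h0 (hpq.trans hqm) hm] at this

theorem ext_of_seg_zero {x y : GMor Λ} (hlen : ∀ i, x.len i = y.len i)
    (h : ∀ n : Fin k → ℕ, (∀ i, (n i : ℕ∞) ≤ x.len i) → x.seg 0 n = y.seg 0 n) : x = y := by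
  have hl : x.len = y.len := funext hlen
  have hs : x.seg = y.seg := by
    funext p q
    by_cases hpq : p ≤ q ∧ ∀ i, (q i : ℕ∞) ≤ x.len i
    · rw [← x.seg_seg hpq.1 le_rfl hpq.2, ← y.seg_seg hpq.1 le_rfl (hl ▸ hpq.2), h q hpq.2]
    · rw [x.seg_junk p q hpq, y.seg_junk p q (hl ▸ hpq), h 0 x.zero_le_len]
  cases x
  cases y
  cases hl
  cases hs
  rfl

/-- The limit of a directed family of finite paths. -/
theorem exists_limit {I : Set Λ.Path} (hne : I.Nonempty) (hdir : DirectedOn Λ.IsPrefix I) :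
    ∃ x : GMor Λ, (∀ lam ∈ I, ∀ i, (Λ.d lam i : ℕ∞) ≤ x.len i) ∧
      (∀ lam ∈ I, ∀ p q, p ≤ q → q ≤ Λ.d lam → x.seg p q = Λ.seg lam p q) ∧
      ∀ q : Fin k → ℕ, (∀ i, (q i : ℕ∞) ≤ x.len i) → ∃ lam ∈ I, q ≤ Λ.d lam := by
  obtain ⟨l0, hl0⟩ := hne
  set L : Fin k → ℕ∞ := fun i => ⨆ lam : I, (Λ.d lam.1 i : ℕ∞) with hL
  have hcons : ∀ a ∈ I, ∀ b ∈ I, ∀ p q, p ≤ q → q ≤ Λ.d a → q ≤ Λ.d b →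
      Λ.seg a p q = Λ.seg b p q := by
    intro a ha b hb p q hpq hqa hqb
    obtain ⟨c, -, hac, hbc⟩ := hdir a ha b hb
    rw [← hac.seg_eq hpq hqa, hbc.seg_eq hpq hqb]
  have hcof : ∀ q : Fin k → ℕ, (∀ i, (q i : ℕ∞) ≤ L i) → ∃ lam ∈ I, q ≤ Λ.d lam := by
    intro q hq
    have h1 : ∀ i, ∃ lam ∈ I, q i ≤ Λ.d lam i := by
      intro i
      by_contra! hc
      have h2 : L i ≤ ((q i - 1 : ℕ) : ℕ∞) := by
        refine iSup_le fun lam => Nat.cast_le.2 ?_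
        have := hc lam.1 lam.2
        omega
      have h3 := Nat.cast_le.1 ((hq i).trans h2)
      have := hc l0 hl0
      omega
    have h2 : ∀ s : Finset (Fin k), ∃ lam ∈ I, ∀ i ∈ s, q i ≤ Λ.d lam i := by
      intro s
      induction s using Finset.induction_on with
      | empty => exact ⟨l0, hl0, by simp⟩
      | insert i s _ ih =>
        obtain ⟨a, ha, has⟩ := ih
        obtain ⟨b, hb, hbi⟩ := h1 i
        obtain ⟨c, hc, hac, hbc⟩ := hdir a ha b hb
        refine ⟨c, hc, fun j hj => ?_⟩
        rcases Finset.mem_insert.1 hj with rfl | hj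
        · exact hbi.trans (hbc.d_le _)
        · exact (has j hj).trans (hac.d_le _)
    obtain ⟨lam, hlam, h⟩ := h2 Finset.univ
    exact ⟨lam, hlam, fun i => h i (Finset.mem_univ i)⟩
  have : Nonempty Λ.Path := ⟨l0⟩
  choose! g hgI hg using hcof
  have hr : ∀ a ∈ I, Λ.r a = Λ.r l0 := by
    intro a ha
    obtain ⟨c, -, hac, hbc⟩ := hdir a ha l0 hl0
    rw [← hac.range_eq, hbc.range_eq]
  have hmono : ∀ {p q : Fin k → ℕ}, p ≤ q → (∀ i, (q i : ℕ∞) ≤ L i) → ∀ i, (p i : ℕ∞) ≤ L i :=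
    fun hpq hq i => (Nat.cast_le.2 (hpq i)).trans (hq i)
  set σ : (Fin k → ℕ) → (Fin k → ℕ) → Λ.Path := fun p q =>
    if p ≤ q ∧ ∀ i, (q i : ℕ∞) ≤ L i then Λ.seg (g q) p q else Λ.r l0
  have hσ : ∀ p q, p ≤ q → (∀ i, (q i : ℕ∞) ≤ L i) → ∀ a ∈ I, q ≤ Λ.d a →
      σ p q = Λ.seg a p q := by
    intro p q hpq hq a ha hqa
    simp only [σ, if_pos (And.intro hpq hq)]
    exact hcons _ (hgI q hq) a ha p q hpq (hg q hq) hqa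
  have h00 : ∀ i, (((0 : Fin k → ℕ) i : ℕ) : ℕ∞) ≤ L i := fun i => by simp
  refine ⟨⟨L, σ, ?_, ?_, ?_, ?_, ?_⟩, ?_, ?_, ?_⟩
  · intro p q hpq hq
    rw [hσ p q hpq hq _ (hgI q hq) (hg q hq), KGraph.d_seg hpq (hg q hq)]
  · intro p q hpq hq
    rw [hσ p q hpq hq _ (hgI q hq) (hg q hq),
      hσ p p le_rfl (hmono hpq hq) _ (hgI q hq) (hpq.trans (hg q hq)),
      KGraph.range_seg hpq (hg q hq)]
  · intro p q hpq hq
    rw [hσ p q hpq hq _ (hgI q hq) (hg q hq), hσ q q le_rfl hq _ (hgI q hq) (hg q hq),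
      KGraph.source_seg hpq (hg q hq)]
  · intro p q u hpq hqu hu
    rw [hσ p q hpq (hmono hqu hu) _ (hgI u hu) (hqu.trans (hg u hu)),
      hσ q u hqu hu _ (hgI u hu) (hg u hu), hσ p u (hpq.trans hqu) hu _ (hgI u hu) (hg u hu),
      (KGraph.comp_seg hpq hqu (hg u hu)).2]
  · intro p q hpq
    rw [hσ 0 0 le_rfl h00 l0 hl0 (fun _ => Nat.zero_le _), KGraph.seg_zero_zero]
    exact if_neg hpq
  · exact fun lam hlam i => le_iSup (fun lam : I => (Λ.d lam.1 i : ℕ∞)) ⟨lam, hlam⟩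
  · intro lam hlam p q hpq hq
    exact hσ p q hpq (fun i => (Nat.cast_le.2 (hq i)).trans
      (le_iSup (fun lam : I => (Λ.d lam.1 i : ℕ∞)) ⟨lam, hlam⟩)) lam hlam hq
  · exact fun q hq => ⟨g q, hgI q hq, hg q hq⟩

theorem IsExtension.right_unique {x x' y : GMor Λ} {lam : Λ.Path} (h : y.IsExtension lam x)
    (h' : y.IsExtension lam x') : x = x' := by
  have hl : ∀ i, x.len i = x'.len i := fun i =>
    (ENat.addLECancellable_natCast (Λ.d lam i)).inj.1 ((h.1 i).symm.trans (h'.1 i))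
  refine ext_of_seg_zero hl fun n hn => ?_
  rw [← h.2.2 n hn, ← h'.2.2 n fun i => hl i ▸ hn i]

theorem IsExtension.hasInit {x y : GMor Λ} {lam : Λ.Path} (h : y.IsExtension lam x) :
    y.HasInit {lam} :=
  ⟨lam, rfl, fun i => h.1 i ▸ le_self_add, h.2.1⟩

theorem isExtension_of_isVertex {x : GMor Λ} {v : Λ.Path} (hv : Λ.IsVertex v)
    (h : x.range = v) : x.IsExtension v x := by
  rw [KGraph.IsVertex] at hv
  refine ⟨fun i => by simp [hv], ?_, fun n _ => ?_⟩
  · rw [hv]; exact h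
  · rw [hv, zero_add]

theorem HasInit.range_eq {x : GMor Λ} {E : Set Λ.Path} (h : x.HasInit E) :
    ∃ lam ∈ E, x.range = Λ.r lam := by
  obtain ⟨lam, hlam, hle, hseg⟩ := h
  refine ⟨lam, hlam, ?_⟩
  rw [← hseg, x.r_seg 0 _ (fun _ => Nat.zero_le _) hle, range]

end GMor

namespace KGraph

variable {k : ℕ} {Λ : KGraph k} {𝓔 : Set (Set Λ.Path)}

variable (Λ) in
/-- A path out of `v` along which `E` can still be avoided: what remains of `E` beyond `lam` is
contained in a finite set of nontrivial paths which does not belong to `𝓔`. -/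
def Avoids (𝓔 : Set (Set Λ.Path)) (E : Set Λ.Path) (v lam : Λ.Path) : Prop :=
  Λ.r lam = v ∧ ∃ H : Set Λ.Path, H.Finite ∧ H ∉ 𝓔 ∧
    (∀ e ∈ H, Λ.r e = Λ.s lam ∧ ¬ Λ.IsVertex e) ∧
    ∀ x, Λ.s lam = Λ.r x → Λ.comp lam x ∈ Λ.setLam E → x ∈ Λ.setLam H

theorem avoids_self {E : Set Λ.Path} {v : Λ.Path} (hv : Λ.IsVertex v) (hE : E.Finite)
    (hEv : ∀ e ∈ E, Λ.r e = v ∧ ¬ Λ.IsVertex e) (hE𝓔 : E ∉ 𝓔) : Λ.Avoids 𝓔 E v v := by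
  refine ⟨range_eq_of_isVertex hv, E, hE, hE𝓔, ?_, fun x hx h => ?_⟩
  · rwa [source_eq_of_isVertex hv]
  · rw [source_eq_of_isVertex hv] at hx
    rwa [hx, Λ.range_comp] at h

theorem Avoids.notMem_setLam {E : Set Λ.Path} {v lam : Λ.Path} (h : Λ.Avoids 𝓔 E v lam) :
    lam ∉ Λ.setLam E := by
  obtain ⟨-, H, -, -, hH, hHE⟩ := h
  intro hlam
  obtain ⟨e, he, hpre⟩ := hHE (Λ.s lam) (Λ.r_s lam).symm (by rwa [Λ.comp_source])
  refine (hH e he).2 (le_antisymm ?_ fun _ => Nat.zero_le _)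
  exact (IsPrefix.d_le hpre).trans_eq (Λ.d_s lam)

theorem Avoids.exists_extension (hΛ : Λ.FinitelyAligned) (h𝓔 : Λ.Satiated 𝓔) {E : Set Λ.Path}
    {v lam : Λ.Path} (h : Λ.Avoids 𝓔 E v lam) {m : Fin k → ℕ} (hm : m ≤ Λ.d lam)
    {F : Set Λ.Path} (hF : F ∈ 𝓔) (hFm : Λ.FEat (Λ.seg lam m m) F) :
    ∃ mu, Λ.Avoids 𝓔 E v mu ∧ Λ.IsPrefix lam mu ∧
      ∃ e ∈ F, m + Λ.d e ≤ Λ.d mu ∧ Λ.seg mu m (m + Λ.d e) = e := by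
  have hvert := source_seg (p := 0) (fun _ => Nat.zero_le _) hm
  obtain ⟨a, b, hab, rfl, rfl⟩ := exists_comp_eq hm
  rw [seg_comp_zero hab] at hvert
  rw [← hvert] at hFm
  by_cases hb : b ∈ Λ.setLam F
  · obtain ⟨e, he, hpre⟩ := hb
    exact ⟨_, h, IsPrefix.refl _, e, he, seg_of_isPrefix_comp hab hpre⟩
  · have hG := h𝓔.2.2.1 F hF _ hFm b hab.symm hb
    have hGb := h𝓔.FEat_of_forall_range_eq hG fun x hx => hx.1
    obtain ⟨hr, H, hHf, hH𝓔, hH, hHE⟩ := h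
    have hsab := Λ.s_comp a b hab
    rw [hsab] at hH
    obtain ⟨c, hcG, hcH, hc𝓔⟩ := h𝓔.exists_Ext_notMem hG hGb hHf hH hH𝓔
    have hbc : Λ.s b = Λ.r c := hcG.1.symm
    have habc : Λ.s (Λ.comp a b) = Λ.r c := hsab.trans hbc
    refine ⟨Λ.comp (Λ.comp a b) c, ⟨by rw [Λ.r_comp _ c habc, hr], Λ.Ext c H,
      hΛ.finite_Ext c hHf, hc𝓔, fun e he => ⟨?_, not_isVertex_of_mem_Ext hcH he⟩,
      fun x hx hxE => ?_⟩, ⟨c, habc, rfl⟩, ?_⟩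
    · rw [Λ.s_comp _ c habc, he.1]
    · rw [Λ.s_comp _ c habc] at hx
      rw [Λ.comp_assoc _ c x habc hx] at hxE
      exact mem_setLam_Ext hx (hHE _ (by rw [Λ.r_comp c x hx, habc]) hxE)
    · obtain ⟨e, he, hpre⟩ := comp_mem_setLam_of_mem_Ext hcG
      rw [Λ.comp_assoc a b c hab hbc]
      exact ⟨e, he, seg_of_isPrefix_comp (by rw [Λ.r_comp b c hbc, hab]) hpre⟩

theorem Satiated.finite_of_mem (h𝓔 : Λ.Satiated 𝓔) {F : Set Λ.Path} (hF : F ∈ 𝓔) :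
    F.Finite := by
  obtain ⟨w, hw⟩ := h𝓔.1 hF
  exact hw.2.2.1

theorem Satiated.empty_notMem (h𝓔 : Λ.Satiated 𝓔) : ∅ ∉ 𝓔 := by
  intro h
  obtain ⟨w, hw⟩ := h𝓔.1 h
  exact Set.not_nonempty_empty hw.nonempty

/-- A finite set of nontrivial paths out of `v` outside `𝓔` is avoided by a compatible boundary
path out of `v`. -/
theorem exists_isBdry_not_hasInit (hΛ : Λ.FinitelyAligned) (h𝓔 : Λ.Satiated 𝓔) {E : Set Λ.Path}
    {v : Λ.Path} (hv : Λ.IsVertex v) (hE : E.Finite)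
    (hEv : ∀ e ∈ E, Λ.r e = v ∧ ¬ Λ.IsVertex e) (hE𝓔 : E ∉ 𝓔) :
    ∃ x : GMor Λ, Λ.IsBdry 𝓔 x ∧ x.range = v ∧ ¬ x.HasInit E := by
  let : Preorder {lam // Λ.Avoids 𝓔 E v lam} :=
    { le := fun a b => Λ.IsPrefix a.1 b.1
      le_refl := fun a => IsPrefix.refl a.1
      le_trans := fun a b c => IsPrefix.trans }
  have := Λ.countable
  let : Encodable ((Fin k → ℕ) × Finset Λ.Path) := Encodable.ofCountable _
  let D : (Fin k → ℕ) × Finset Λ.Path → Order.Cofinal {lam // Λ.Avoids 𝓔 E v lam} := fun t =>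
    { carrier := {a | ∀ b, a ≤ b → t.1 ≤ Λ.d b.1 → (t.2 : Set Λ.Path) ∈ 𝓔 →
        Λ.FEat (Λ.seg b.1 t.1 t.1) t.2 →
        ∃ e ∈ t.2, t.1 + Λ.d e ≤ Λ.d b.1 ∧ Λ.seg b.1 t.1 (t.1 + Λ.d e) = e}
      isCofinal := by
        intro a
        by_cases ha : ∃ b, a ≤ b ∧ t.1 ≤ Λ.d b.1 ∧ (t.2 : Set Λ.Path) ∈ 𝓔 ∧
          Λ.FEat (Λ.seg b.1 t.1 t.1) t.2
        · obtain ⟨b, hab, hb, ht, hbt⟩ := ha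
          obtain ⟨c, hc, hbc, e, he, hle, hseg⟩ := b.2.exists_extension hΛ h𝓔 hb ht hbt
          refine ⟨⟨c, hc⟩, fun f hf _ _ _ => ⟨e, he, hle.trans (IsPrefix.d_le hf), ?_⟩,
            le_trans hab hbc⟩
          rw [IsPrefix.seg_eq hf le_self_add hle, hseg]
        · push Not at ha
          exact ⟨a, fun b hab hb ht hbt => absurd hbt (ha b hab hb ht), le_rfl⟩ }
  let p0 : {lam // Λ.Avoids 𝓔 E v lam} := ⟨v, avoids_self hv hE hEv hE𝓔⟩
  let I := Order.idealOfCofinals p0 D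
  have hI0 : p0 ∈ I := Order.mem_idealOfCofinals p0 D
  obtain ⟨x, hxlen, hxseg, hxcof⟩ := GMor.exists_limit (I := Subtype.val '' (I : Set _))
    ⟨v, p0, hI0, rfl⟩ (by
      rintro _ ⟨a, ha, rfl⟩ _ ⟨b, hb, rfl⟩
      obtain ⟨c, hc, hac, hbc⟩ := I.directed a ha b hb
      exact ⟨c.1, ⟨c, hc, rfl⟩, hac, hbc⟩)
  refine ⟨x, fun n hn F hF hFn => ?_, ?_, ?_⟩
  · obtain ⟨a, haD, haI⟩ := Order.cofinal_meets_idealOfCofinals p0 D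
      (n, (h𝓔.finite_of_mem hF).toFinset)
    obtain ⟨_, ⟨b, hbI, rfl⟩, hb⟩ := hxcof n hn
    obtain ⟨c, hcI, hac, hbc⟩ := I.directed a haI b hbI
    have hnc : n ≤ Λ.d c.1 := hb.trans (IsPrefix.d_le hbc)
    have hcI' : c.1 ∈ Subtype.val '' (I : Set {lam // Λ.Avoids 𝓔 E v lam}) := ⟨c, hcI, rfl⟩
    rw [hxseg c.1 hcI' n n le_rfl hnc] at hFn
    obtain ⟨e, he, hle, hseg⟩ := haD c hac hnc
      (by rwa [Set.Finite.coe_toFinset]) (by rwa [Set.Finite.coe_toFinset])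
    refine ⟨e, (Set.Finite.mem_toFinset _).1 he, fun i =>
      (Nat.cast_le.2 (hle i)).trans (hxlen c.1 hcI' i), ?_⟩
    rw [hxseg c.1 hcI' n _ le_self_add hle]
    exact hseg
  · rw [GMor.range, hxseg v ⟨p0, hI0, rfl⟩ 0 0 le_rfl (fun _ => Nat.zero_le _), seg_zero_zero,
      range_eq_of_isVertex hv]
  · rintro ⟨e, he, hle, hseg⟩
    obtain ⟨_, ⟨b, hbI, rfl⟩, hb⟩ := hxcof _ hle
    rw [hxseg b.1 ⟨b, hbI, rfl⟩ 0 _ (fun _ => Nat.zero_le _) hb] at hseg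
    exact b.2.notMem_setLam ⟨e, he, hseg ▸ (isPrefix_seg_zero hb).1⟩

/-- Removing an initial segment from a compatible boundary path. -/
theorem IsBdry.exists_restriction {y : GMor Λ} (hy : Λ.IsBdry 𝓔 y) {lam : Λ.Path}
    (h : y.HasInit {lam}) :
    ∃ x : GMor Λ, Λ.IsBdry 𝓔 x ∧ Λ.s lam = x.range ∧ y.IsExtension lam x := by
  obtain ⟨lam', hlam', hle, hseg⟩ := h
  rw [Set.mem_singleton_iff.1 hlam'] at hle hseg
  set m := Λ.d lam
  have key : ∀ q : Fin k → ℕ, (∀ i, (q i : ℕ∞) ≤ y.len i - (m i : ℕ∞)) ↔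
      ∀ i, ((m + q) i : ℕ∞) ≤ y.len i := by
    intro q
    refine forall_congr' fun i => ?_
    rw [(ENat.addLECancellable_natCast (m i)).le_tsub_iff_left (hle i), Pi.add_apply, Nat.cast_add]
  have hadd : ∀ {p q : Fin k → ℕ}, p ≤ q → m + p ≤ m + q := fun h => add_le_add_right h m
  have h00 : ∀ i, (((0 : Fin k → ℕ) i : ℕ) : ℕ∞) ≤ y.len i - (m i : ℕ∞) := fun i => by simp
  let x : GMor Λ :=
    { len := fun i => y.len i - (m i : ℕ∞)
      seg := fun p q => if p ≤ q ∧ ∀ i, (q i : ℕ∞) ≤ y.len i - (m i : ℕ∞) then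
        y.seg (m + p) (m + q) else y.seg (m + 0) (m + 0)
      d_seg := fun p q hpq hq => by
        rw [if_pos ⟨hpq, hq⟩, y.d_seg _ _ (hadd hpq) ((key q).1 hq), add_tsub_add_eq_tsub_left]
      r_seg := fun p q hpq hq => by
        rw [if_pos ⟨hpq, hq⟩, if_pos ⟨le_rfl, fun i => (Nat.cast_le.2 (hpq i)).trans (hq i)⟩,
          y.r_seg _ _ (hadd hpq) ((key q).1 hq)]
      s_seg := fun p q hpq hq => by
        rw [if_pos ⟨hpq, hq⟩, if_pos ⟨le_rfl, hq⟩, y.s_seg _ _ (hadd hpq) ((key q).1 hq)]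
      comp_seg := fun p q u hpq hqu hu => by
        rw [if_pos ⟨hpq, fun i => (Nat.cast_le.2 (hqu i)).trans (hu i)⟩, if_pos ⟨hqu, hu⟩,
          if_pos ⟨hpq.trans hqu, hu⟩, y.comp_seg _ _ _ (hadd hpq) (hadd hqu) ((key u).1 hu)]
      seg_junk := fun p q hpq => by
        rw [if_neg hpq, if_pos ⟨le_rfl, h00⟩] }
  have hx : ∀ p q : Fin k → ℕ, p ≤ q → (∀ i, ((m + q) i : ℕ∞) ≤ y.len i) →
      x.seg p q = y.seg (m + p) (m + q) := fun p q hpq hq => if_pos ⟨hpq, (key q).2 hq⟩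
  refine ⟨x, fun n hn F hF hFn => ?_, ?_, fun i => ?_, hseg, fun n hn => ?_⟩
  · have hn' := (key n).1 hn
    rw [hx n n le_rfl hn'] at hFn
    obtain ⟨e, he, hle', hseg'⟩ := hy _ hn' F hF hFn
    rw [add_assoc] at hle' hseg'
    exact ⟨e, he, (key _).2 hle', by rw [hx _ _ le_self_add hle', hseg']⟩
  · have := y.s_seg 0 m (fun _ => Nat.zero_le _) hle
    rw [hseg] at this
    rw [this, GMor.range, hx 0 0 le_rfl (by simpa using hle), add_zero]
  · exact (add_tsub_cancel_of_le (hle i)).symm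
  · have := hx 0 n (fun _ => Nat.zero_le _) ((key n).1 hn)
    rw [this, add_zero]

/-- Prefixing a compatible boundary path by a finite path. -/
theorem IsBdry.exists_extension (h𝓔 : Λ.Satiated 𝓔) {x : GMor Λ} (hx : Λ.IsBdry 𝓔 x)
    {lam : Λ.Path} (h : Λ.s lam = x.range) :
    ∃ y : GMor Λ, Λ.IsBdry 𝓔 y ∧ y.IsExtension lam x := by
  have h0 : ∀ n : Fin k → ℕ, 0 ≤ n := fun n _ => Nat.zero_le _
  have hr : ∀ n : Fin k → ℕ, (∀ i, (n i : ℕ∞) ≤ x.len i) → Λ.s lam = Λ.r (x.seg 0 n) :=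
    fun n hn => by rw [h, x.r_seg 0 n (h0 n) hn, GMor.range]
  have hd : ∀ n : Fin k → ℕ, (∀ i, (n i : ℕ∞) ≤ x.len i) →
      Λ.d (Λ.comp lam (x.seg 0 n)) = Λ.d lam + n := fun n hn => by
    rw [Λ.d_comp _ _ (hr n hn), x.d_seg 0 n (h0 n) hn, tsub_zero]
  have hpre : ∀ n m : Fin k → ℕ, n ≤ m → (∀ i, (m i : ℕ∞) ≤ x.len i) →
      Λ.IsPrefix (Λ.comp lam (x.seg 0 n)) (Λ.comp lam (x.seg 0 m)) := by
    intro n m hnm hm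
    have hn := GMor.le_len_of_le hnm hm
    have hs : Λ.s (x.seg 0 n) = Λ.r (x.seg n m) := by
      rw [x.s_seg 0 n (h0 n) hn, x.r_seg n m hnm hm]
    exact ⟨x.seg n m, by rw [Λ.s_comp _ _ (hr n hn), hs],
      by rw [Λ.comp_assoc _ _ _ (hr n hn) hs, x.comp_seg 0 n m (h0 n) hnm hm]⟩
  obtain ⟨y, hylen, hyseg, hycof⟩ := GMor.exists_limit
    (I := {a | ∃ n : Fin k → ℕ, (∀ i, (n i : ℕ∞) ≤ x.len i) ∧ Λ.comp lam (x.seg 0 n) = a})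
    ⟨_, 0, x.zero_le_len, rfl⟩ (by
      rintro _ ⟨n, hn, rfl⟩ _ ⟨m, hm, rfl⟩
      have hnm : ∀ i, ((n ⊔ m) i : ℕ∞) ≤ x.len i := fun i => by
        rcases le_total (n i) (m i) with h | h
        · rw [Pi.sup_apply, sup_eq_right.2 h]; exact hm i
        · rw [Pi.sup_apply, sup_eq_left.2 h]; exact hn i
      exact ⟨_, ⟨_, hnm, rfl⟩, hpre _ _ le_sup_left hnm, hpre _ _ le_sup_right hnm⟩)
  have hlen : ∀ i, y.len i = (Λ.d lam i : ℕ∞) + x.len i := by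
    intro i
    refine ENat.eq_of_forall_natCast_le_iff fun n => ⟨fun hn => ?_, fun hn => ?_⟩
    · obtain ⟨_, ⟨m, hm, rfl⟩, hle⟩ := hycof (Pi.single i n) (fun j => by
        rcases eq_or_ne j i with rfl | hj
        · simpa using hn
        · simp [hj])
      have := hle i
      rw [Pi.single_eq_same, hd m hm] at this
      calc (n : ℕ∞) ≤ ((Λ.d lam i + m i : ℕ) : ℕ∞) := Nat.cast_le.2 this
        _ = Λ.d lam i + m i := Nat.cast_add _ _
        _ ≤ _ := add_le_add_right (hm i) _
    · have hm : ∀ j, ((Pi.single i (n - Λ.d lam i) : Fin k → ℕ) j : ℕ∞) ≤ x.len j := fun j => by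
        rcases eq_or_ne j i with rfl | hj
        · simpa [tsub_le_iff_left, add_comm] using hn
        · simp [hj]
      refine le_trans ?_ (hylen _ ⟨_, hm, rfl⟩ i)
      rw [hd _ hm, Pi.add_apply, Pi.single_eq_same]
      exact Nat.cast_le.2 le_add_tsub
  have hyx : ∀ p q : Fin k → ℕ, p ≤ q → (∀ i, (q i : ℕ∞) ≤ x.len i) →
      y.seg (Λ.d lam + p) (Λ.d lam + q) = x.seg p q := by
    intro p q hpq hq
    have hp := GMor.le_len_of_le hpq hq
    have h1 : Λ.s (x.seg 0 p) = Λ.r (x.seg p q) := by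
      rw [x.s_seg 0 p (h0 p) hp, x.r_seg p q hpq hq]
    rw [hyseg _ ⟨q, hq, rfl⟩ _ _ (add_le_add_right hpq _) (hd q hq).ge,
      ← x.comp_seg 0 p q (h0 p) hpq hq, ← Λ.comp_assoc _ _ _ (hr p hp) h1, ← hd p hp]
    have h2 : Λ.d lam + q = Λ.d (Λ.comp lam (x.seg 0 p)) + Λ.d (x.seg p q) := by
      rw [hd p hp, x.d_seg p q hpq hq, add_assoc, add_tsub_cancel_of_le hpq]
    rw [h2]
    have := seg_comp_comp (a := Λ.comp lam (x.seg 0 p)) (b := x.seg p q) (c := Λ.s (x.seg p q))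
      (by rw [Λ.s_comp _ _ (hr p hp), h1]) (Λ.r_s _).symm
    rwa [Λ.comp_source] at this
  have hy0 : y.seg 0 (Λ.d lam) = lam := by
    have := hd 0 x.zero_le_len
    rw [add_zero] at this
    rw [hyseg _ ⟨0, x.zero_le_len, rfl⟩ 0 _ (h0 _) this.ge, seg_comp_zero (hr 0 x.zero_le_len)]
  refine ⟨y, fun n hn F hF hFn => ?_, hlen, hy0, fun n hn => ?_⟩
  · set p := (n ⊔ Λ.d lam) - Λ.d lam with hp
    have hpeq : Λ.d lam + p = n ⊔ Λ.d lam := add_tsub_cancel_of_le le_sup_right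
    have hnp : n ≤ Λ.d lam + p := le_sup_left.trans_eq hpeq.symm
    have hpx : ∀ i, (p i : ℕ∞) ≤ x.len i := by
      intro i
      have h1 : ((Λ.d lam i + p i : ℕ) : ℕ∞) ≤ y.len i := by
        have := congrFun hpeq i
        rw [Pi.add_apply, Pi.sup_apply] at this
        rw [this]
        rcases le_total (n i) (Λ.d lam i) with h | h
        · rw [sup_eq_right.2 h, hlen]; exact le_self_add
        · rw [sup_eq_left.2 h]; exact hn i
      rw [hlen, Nat.cast_add] at h1
      exact ENat.addLECancellable_natCast _ h1
    have hpy : ∀ q : Fin k → ℕ, (∀ i, (q i : ℕ∞) ≤ x.len i) →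
        ∀ i, ((Λ.d lam + q) i : ℕ∞) ≤ y.len i := fun q hq i => by
      rw [hlen, Pi.add_apply, Nat.cast_add]
      exact add_le_add_right (hq i) _
    set mu := y.seg n (Λ.d lam + p) with hmu
    have hdmu : n + Λ.d mu = Λ.d lam + p := by
      rw [hmu, y.d_seg _ _ hnp (hpy p hpx), add_tsub_cancel_of_le hnp]
    have hrmu : Λ.r mu = y.seg n n := y.r_seg _ _ hnp (hpy p hpx)
    have hsmu : Λ.s mu = x.seg p p := by
      rw [hmu, y.s_seg _ _ hnp (hpy p hpx), hyx p p le_rfl hpx]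
    -- any member of `F` which is a prefix of a path `y(n,u)` does the job
    have hfin : ∀ u : Fin k → ℕ, n ≤ u → (∀ i, (u i : ℕ∞) ≤ y.len i) →
        y.seg n u ∈ Λ.setLam F → ∃ e ∈ F, (∀ i, ((n + Λ.d e) i : ℕ∞) ≤ y.len i) ∧
          y.seg n (n + Λ.d e) = e := by
      rintro u hnu hu ⟨e, he, hpre⟩
      have hd1 := y.d_seg _ _ hnu hu
      have hle : n + Λ.d e ≤ u := by
        have := add_le_add_right (IsPrefix.d_le hpre) n
        rwa [hd1, add_tsub_cancel_of_le hnu] at this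
      have hle' := GMor.le_len_of_le hle hu
      refine ⟨e, he, hle', ?_⟩
      have h1 : Λ.IsPrefix (y.seg n (n + Λ.d e)) (y.seg n u) :=
        ⟨y.seg (n + Λ.d e) u, by
          rw [y.s_seg _ _ le_self_add hle', y.r_seg _ _ hle hu],
          y.comp_seg _ _ _ le_self_add hle hu⟩
      have h2 := h1.seg_zero
      rw [y.d_seg _ _ le_self_add hle', add_tsub_cancel_left, IsPrefix.seg_zero hpre] at h2
      exact h2.symm
    by_cases hmuF : mu ∈ Λ.setLam F
    · exact hfin _ hnp (hpy p hpx) hmuF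
    · have hG := h𝓔.2.2.1 F hF _ hFn mu hrmu hmuF
      have hGm := h𝓔.FEat_of_forall_range_eq hG fun a ha => ha.1
      rw [hsmu] at hGm
      obtain ⟨a, ha, hale, haseg⟩ := hx p hpx _ hG hGm
      have hu := hpy _ hale
      have hle : Λ.d lam + p ≤ Λ.d lam + (p + Λ.d a) := add_le_add_right le_self_add _
      refine hfin _ (hnp.trans hle) hu ?_
      rw [← y.comp_seg _ _ _ hnp hle hu, hyx _ _ le_self_add hale, haseg]
      exact comp_mem_setLam_of_mem_Ext ha
  · have := hyx 0 n (h0 n) hn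
    rwa [add_zero] at this

end KGraph

section Operators

variable {ι : Type*} [DecidableEq ι]

theorem lp_clm_eq_zero {T : lp (fun _ : ι => ℂ) 2 →L[ℂ] lp (fun _ : ι => ℂ) 2}
    (h : ∀ i, T (lp.single 2 i 1) = 0) : T = 0 := by
  refine lp.ext_continuousLinearMap (by simp) fun i => ?_
  ext
  simp [h i]

theorem lp_star_apply_single {T : lp (fun _ : ι => ℂ) 2 →L[ℂ] lp (fun _ : ι => ℂ) 2} {j : ι}
    {g : lp (fun _ : ι => ℂ) 2}
    (h : ∀ i, T (lp.single 2 i 1) j = starRingEnd ℂ (g i)) :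
    star T (lp.single 2 j 1) = g := by
  ext i
  have h1 := ContinuousLinearMap.adjoint_inner_right T (lp.single 2 i 1) (lp.single 2 j 1)
  rw [lp.inner_single_left, lp.inner_single_right, h i] at h1
  simpa [ContinuousLinearMap.star_eq_adjoint] using h1

theorem lp_single_one_ne_zero (i : ι) :
    (lp.single 2 i 1 : lp (fun _ : ι => ℂ) 2) ≠ 0 := by
  intro h
  have := congrArg (fun f : lp (fun _ : ι => ℂ) 2 => f i) h
  simp at this

section ListProd

variable {R V : Type*} [Semiring R] [AddCommMonoid V] [TopologicalSpace V] [Module R V]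
  {u : V} {l : List (V →L[R] V)}

theorem list_prod_apply_eq_self (hl : ∀ T ∈ l, T u = u) : l.prod u = u := by
  induction l with
  | nil => rfl
  | cons T l ih =>
    rw [List.forall_mem_cons] at hl
    rw [List.prod_cons, mul_apply_eq_comp, ih hl.2, hl.1]

/-- A product of operators, each of which fixes or kills a vector, kills the vector when one of
the factors does. -/
theorem list_prod_apply_eq_zero (hl : ∀ T ∈ l, T u = u ∨ T u = 0) (h0 : ∃ T ∈ l, T u = 0) :
    l.prod u = 0 := by
  induction l with
  | nil => simp at h0
  | cons T l ih =>
    rw [List.forall_mem_cons] at hl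
    rw [List.prod_cons, mul_apply_eq_comp]
    by_cases h : ∃ T ∈ l, T u = 0
    · rw [ih hl.2 h, map_zero]
    · push Not at h
      rw [list_prod_apply_eq_self fun T' hT' => (hl.2 T' hT').resolve_right (h T' hT')]
      rcases List.exists_mem_cons_iff .. |>.1 h0 with h0 | ⟨T', hT', h0⟩
      · exact h0
      · exact absurd h0 (h T' hT')

end ListProd

end Operators

theorem GMor.hasInit_iff_exists_singleton {k : ℕ} {Λ : KGraph k} {x : GMor Λ} {E : Set Λ.Path} :
    x.HasInit E ↔ ∃ lam ∈ E, x.HasInit {lam} := by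
  simp [GMor.HasInit]

namespace KGraph

variable {k : ℕ} {Λ : KGraph k} {𝓔 : Set (Set Λ.Path)}

theorem vertex_apply_single
    {S : Λ.Path →
      (lp (fun _ : {x : GMor Λ // Λ.IsBdry 𝓔 x} => ℂ) 2 →L[ℂ]
        lp (fun _ : {x : GMor Λ // Λ.IsBdry 𝓔 x} => ℂ) 2)}
    (hS : ∀ (lam : Λ.Path) (x y : {x : GMor Λ // Λ.IsBdry 𝓔 x}),
      Λ.s lam = x.1.range → y.1.IsExtension lam x.1 →
      S lam (lp.single 2 x 1) = lp.single 2 y 1)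
    {v : Λ.Path} (hv : Λ.IsVertex v) (x : {x : GMor Λ // Λ.IsBdry 𝓔 x})
    (hx : x.1.range = v) : S v (lp.single 2 x 1) = lp.single 2 x 1 :=
  hS v x x (by rw [source_eq_of_isVertex hv, hx]) (GMor.isExtension_of_isVertex hv hx)

/-- `S λ S λ*` fixes the basis vectors of the boundary paths starting with `λ`. -/
theorem rangeProj_apply_single_of_hasInit (h𝓔 : Λ.Satiated 𝓔)
    {S : Λ.Path →
      (lp (fun _ : {x : GMor Λ // Λ.IsBdry 𝓔 x} => ℂ) 2 →L[ℂ]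
        lp (fun _ : {x : GMor Λ // Λ.IsBdry 𝓔 x} => ℂ) 2)}
    (hS : ∀ (lam : Λ.Path) (x y : {x : GMor Λ // Λ.IsBdry 𝓔 x}),
      Λ.s lam = x.1.range → y.1.IsExtension lam x.1 →
      S lam (lp.single 2 x 1) = lp.single 2 y 1)
    (hS0 : ∀ (lam : Λ.Path) (x : {x : GMor Λ // Λ.IsBdry 𝓔 x}),
      Λ.s lam ≠ x.1.range → S lam (lp.single 2 x 1) = 0)
    {lam : Λ.Path} {y : {x : GMor Λ // Λ.IsBdry 𝓔 x}} (hy : y.1.HasInit {lam}) :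
    (S lam * star (S lam)) (lp.single 2 y 1) = lp.single 2 y 1 := by
  obtain ⟨x, hx, hsx, hyx⟩ := y.2.exists_restriction hy
  have hstar : star (S lam) (lp.single 2 y 1) = lp.single 2 ⟨x, hx⟩ 1 := by
    refine lp_star_apply_single fun x' => ?_
    by_cases hx' : x' = ⟨x, hx⟩
    · rw [hx', hS lam _ y hsx hyx]
      simp
    · rw [lp.single_apply_ne 2 _ _ hx', map_zero]
      by_cases hs : Λ.s lam = x'.1.range
      · obtain ⟨z, hz, hzx⟩ := x'.2.exists_extension h𝓔 hs
        rw [hS lam x' ⟨z, hz⟩ hs hzx]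
        refine lp.single_apply_ne 2 _ _ ?_
        rintro rfl
        exact hx' (Subtype.ext (hzx.right_unique hyx))
      · rw [hS0 lam x' hs]
        rfl
  rw [mul_apply_eq_comp, hstar, hS lam _ y hsx hyx]

/-- `S λ S λ*` kills the basis vectors of the boundary paths not starting with `λ`. -/
theorem rangeProj_apply_single_of_not_hasInit (h𝓔 : Λ.Satiated 𝓔)
    {S : Λ.Path →
      (lp (fun _ : {x : GMor Λ // Λ.IsBdry 𝓔 x} => ℂ) 2 →L[ℂ]
        lp (fun _ : {x : GMor Λ // Λ.IsBdry 𝓔 x} => ℂ) 2)}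
    (hS : ∀ (lam : Λ.Path) (x y : {x : GMor Λ // Λ.IsBdry 𝓔 x}),
      Λ.s lam = x.1.range → y.1.IsExtension lam x.1 →
      S lam (lp.single 2 x 1) = lp.single 2 y 1)
    (hS0 : ∀ (lam : Λ.Path) (x : {x : GMor Λ // Λ.IsBdry 𝓔 x}),
      Λ.s lam ≠ x.1.range → S lam (lp.single 2 x 1) = 0)
    {lam : Λ.Path} {y : {x : GMor Λ // Λ.IsBdry 𝓔 x}} (hy : ¬ y.1.HasInit {lam}) :
    (S lam * star (S lam)) (lp.single 2 y 1) = 0 := by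
  have hstar : star (S lam) (lp.single 2 y 1) = 0 := by
    refine lp_star_apply_single fun x' => ?_
    change _ = starRingEnd ℂ 0
    rw [map_zero]
    by_cases hs : Λ.s lam = x'.1.range
    · obtain ⟨z, hz, hzx⟩ := x'.2.exists_extension h𝓔 hs
      rw [hS lam x' ⟨z, hz⟩ hs hzx]
      refine lp.single_apply_ne 2 _ _ ?_
      rintro rfl
      exact hy hzx.hasInit
    · rw [hS0 lam x' hs]
      rfl
  rw [mul_apply_eq_comp, hstar, map_zero]

end KGraph

/-- Corollary 4.11 for the boundary-path representation: all vertex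
projections `S_𝓔(v)` are nonzero, and for finite `E ⊆ vΛ \ Λ⁰`,
`∏_{λ ∈ E} (S_𝓔(v) - S_𝓔(λ)S_𝓔(λ)*) = 0` iff `E ∈ 𝓔`. -/
theorem statement8 {k : ℕ} (Λ : KGraph k) (hΛ : Λ.FinitelyAligned)
    (𝓔 : Set (Set Λ.Path)) (h𝓔 : Λ.Satiated 𝓔)
    (S : Λ.Path →
      (lp (fun _ : {x : GMor Λ // Λ.IsBdry 𝓔 x} => ℂ) 2 →L[ℂ]
        lp (fun _ : {x : GMor Λ // Λ.IsBdry 𝓔 x} => ℂ) 2))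
    (hS : ∀ (lam : Λ.Path) (x y : {x : GMor Λ // Λ.IsBdry 𝓔 x}),
      Λ.s lam = x.1.range → y.1.IsExtension lam x.1 →
      S lam (lp.single 2 x 1) = lp.single 2 y 1)
    (hS0 : ∀ (lam : Λ.Path) (x : {x : GMor Λ // Λ.IsBdry 𝓔 x}),
      Λ.s lam ≠ x.1.range → S lam (lp.single 2 x 1) = 0) :
    (∀ v, Λ.IsVertex v → S v ≠ 0) ∧
      ∀ v, Λ.IsVertex v → ∀ E : Set Λ.Path, E.Finite →
        (∀ lam ∈ E, Λ.r lam = v ∧ ¬ Λ.IsVertex lam) →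
        (Λ.gapProd S v E = 0 ↔ E ∈ 𝓔) := by
  have hne : ∀ v, Λ.IsVertex v → S v ≠ 0 := by
    intro v hv h
    obtain ⟨x, hx, hxv, -⟩ := KGraph.exists_isBdry_not_hasInit hΛ h𝓔 hv Set.finite_empty
      (by simp) h𝓔.empty_notMem
    have := KGraph.vertex_apply_single hS hv ⟨x, hx⟩ hxv
    rw [h, zero_apply] at this
    exact lp_single_one_ne_zero _ this.symm
  refine ⟨hne, fun v hv E hE hEv => ?_⟩
  have hfix : ∀ x : {x : GMor Λ // Λ.IsBdry 𝓔 x}, x.1.range = v → ∀ lam,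
      ¬ x.1.HasInit {lam} →
      (S v - S lam * star (S lam)) (lp.single 2 x 1) = lp.single 2 x 1 := by
    intro x hx lam h
    rw [sub_apply,
      KGraph.rangeProj_apply_single_of_not_hasInit h𝓔 hS hS0 h,
      KGraph.vertex_apply_single hS hv x hx, sub_zero]
  have hkill : ∀ x : {x : GMor Λ // Λ.IsBdry 𝓔 x}, x.1.range = v → ∀ lam,
      x.1.HasInit {lam} → (S v - S lam * star (S lam)) (lp.single 2 x 1) = 0 := by
    intro x hx lam h
    rw [sub_apply,
      KGraph.rangeProj_apply_single_of_hasInit h𝓔 hS hS0 h,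
      KGraph.vertex_apply_single hS hv x hx, sub_self]
  have hkill' : ∀ x : {x : GMor Λ // Λ.IsBdry 𝓔 x}, x.1.range ≠ v → ∀ lam ∈ E,
      (S v - S lam * star (S lam)) (lp.single 2 x 1) = 0 := by
    intro x hx lam hlam
    have h : ¬ x.1.HasInit {lam} := fun h => by
      obtain ⟨lam', hl, hr⟩ := h.range_eq
      rw [Set.mem_singleton_iff.1 hl] at hr
      exact hx (hr.trans (hEv _ hlam).1)
    rw [sub_apply,
      KGraph.rangeProj_apply_single_of_not_hasInit h𝓔 hS hS0 h,
      hS0 v x (by rw [KGraph.source_eq_of_isVertex hv]; exact hx.symm), sub_zero]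
  rw [KGraph.gapProd, listProd, dif_pos hE]
  constructor
  · intro h
    by_contra hE𝓔
    obtain ⟨x, hx, hxv, hxE⟩ := KGraph.exists_isBdry_not_hasInit hΛ h𝓔 hv hE hEv hE𝓔
    rw [GMor.hasInit_iff_exists_singleton] at hxE
    push Not at hxE
    have hprod := list_prod_apply_eq_self
      (l := hE.toFinset.toList.map fun lam => S v - S lam * star (S lam))
      (u := lp.single 2 (⟨x, hx⟩ : {x : GMor Λ // Λ.IsBdry 𝓔 x}) 1) (by
        simp only [List.mem_map, Finset.mem_toList, Set.Finite.mem_toFinset]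
        rintro _ ⟨lam, hlam, rfl⟩
        exact hfix ⟨x, hx⟩ hxv lam (hxE lam hlam))
    rw [h, zero_apply] at hprod
    exact lp_single_one_ne_zero _ hprod.symm
  · intro hE𝓔
    have hFE := h𝓔.FEat_of_forall_range_eq hE𝓔 fun lam hlam => (hEv lam hlam).1
    refine lp_clm_eq_zero fun x => list_prod_apply_eq_zero ?_ ?_
    · simp only [List.mem_map, Finset.mem_toList, Set.Finite.mem_toFinset]
      rintro _ ⟨lam, hlam, rfl⟩
      by_cases hxv : x.1.range = v
      · by_cases h : x.1.HasInit {lam}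
        · exact Or.inr (hkill x hxv lam h)
        · exact Or.inl (hfix x hxv lam h)
      · exact Or.inr (hkill' x hxv lam hlam)
    · simp only [List.mem_map, Finset.mem_toList, Set.Finite.mem_toFinset]
      by_cases hxv : x.1.range = v
      · obtain ⟨lam, hlam, hle, hseg⟩ := x.2 0 x.1.zero_le_len E hE𝓔 (by
          rwa [show x.1.seg 0 0 = v from hxv])
        rw [zero_add] at hle hseg
        exact ⟨_, ⟨lam, hlam, rfl⟩, hkill x hxv lam ⟨lam, rfl, hle, hseg⟩⟩
      · obtain ⟨lam, hlam⟩ := hFE.nonempty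
        exact ⟨_, ⟨lam, hlam, rfl⟩, hkill' x hxv lam hlam⟩
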